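/- Let K be a separable metric space, let f, g : K → ℝ be bounded functions in B_{1/2}(K) with F = ‖f‖_∞ > 0 and G = ‖g‖_∞ > 0, and let ε > 0. Then i(f·g, ε) ≤ i(f, ε/(2G)) + i(g, ε/(2F)). -/

import Mathlib

open Filter Topology Set

noncomputable section

/-- A real-valued function is bounded. -/
def BddFun {X : Type*} (f : X → ℝ) : Prop := ∃ C, ∀ x, |f x| ≤ C

/-- `f ∈ DBSC(X)`: `f` is a difference of bounded lower semicontinuous functions. -/
def MemDBSC {X : Type*} [TopologicalSpace X] (f : X → ℝ) : Prop :=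
  ∃ u v : X → ℝ, BddFun u ∧ BddFun v ∧ LowerSemicontinuous u ∧ LowerSemicontinuous v ∧
    f = u - v

/-- The D-norm of `f`. -/
def DNorm {X : Type*} [TopologicalSpace X] (f : X → ℝ) : ℝ :=
  sInf {c | ∃ φ : ℕ → X → ℝ, (∀ j, Continuous (φ j)) ∧ (∀ x, Summable fun j => |φ j x|) ∧
    (∀ x, ∑' j, φ j x = f x) ∧ (∀ x, ∑' j, |φ j x| ≤ c)}

/-- The sup-norm of `f`. -/
def supNorm {X : Type*} (f : X → ℝ) : ℝ := ⨆ x, |f x|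

/-- A simple D-function: a D-function taking finitely many values. -/
def SimpleD {X : Type*} [TopologicalSpace X] (f : X → ℝ) : Prop :=
  MemDBSC f ∧ (Set.range f).Finite

/-- `f ∈ SD(X)`: `f` is a strong D-function. -/
def MemSD {X : Type*} [TopologicalSpace X] (f : X → ℝ) : Prop :=
  ∃ φ : ℕ → X → ℝ, (∀ n, SimpleD (φ n)) ∧
    Tendsto (fun n => DNorm (f - φ n)) atTop (𝓝 0)

/-- `f ∈ B_{1/2}(X)`: `f` is a uniform limit of D-functions. -/
def MemBHalf {X : Type*} [TopologicalSpace X] (f : X → ℝ) : Prop :=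
  ∃ g : ℕ → X → ℝ, (∀ n, MemDBSC (g n)) ∧ TendstoUniformly g f atTop

/-- The upper semicontinuous envelope `Uf`. -/
def uEnv {X : Type*} [TopologicalSpace X] (f : X → ℝ) (x : X) : ℝ :=
  sInf {c | ∃ V : Set X, IsOpen V ∧ x ∈ V ∧ sSup (f '' V) = c}

/-- The lower oscillation of `f` at `x`. -/
def losc {X : Type*} [TopologicalSpace X] (f : X → ℝ) (x : X) : ℝ :=
  sInf {c | ∃ V : Set X, IsOpen V ∧ x ∈ V ∧ sSup ((fun y => |f y - f x|) '' V) = c}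

/-- The oscillation of `f`: `osc f = U (losc f)`. -/
def osc {X : Type*} [TopologicalSpace X] (f : X → ℝ) : X → ℝ := uEnv (losc f)

/-- The oscillation sets `os_n(f, ε)`. -/
def osSet {X : Type*} [TopologicalSpace X] (f : X → ℝ) (ε : ℝ) : ℕ → Set X
  | 0 => Set.univ
  | n + 1 => {x | ∃ h : x ∈ osSet f ε n, ε ≤ osc ((osSet f ε n).restrict f) ⟨x, h⟩}

/-- The `ε`-oscillation index `i(f, ε) = sup {n : os_n(f,ε) ≠ ∅}`. -/
def oscIndex {X : Type*} [TopologicalSpace X] (f : X → ℝ) (ε : ℝ) : ℕ∞ :=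
  ⨆ (m : ℕ) (_ : (osSet f ε m).Nonempty), (m : ℕ∞)

/-- `f` has finite Baire index. -/
def FiniteBaireIndex {X : Type*} [TopologicalSpace X] (f : X → ℝ) : Prop :=
  ∃ n : ℕ, ∀ ε > 0, osSet f ε n = ∅

/-- The Baire index `i(f) = sup_{ε > 0} i(f, ε)`. -/
def baireIndex {X : Type*} [TopologicalSpace X] (f : X → ℝ) : ℕ∞ :=
  ⨆ (ε : ℝ) (_ : 0 < ε), oscIndex f ε

open scoped ENNReal

theorem BddFun.bddAbove_image {X : Type*} {h : X → ℝ} (hh : BddFun h) (V : Set X) :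
    BddAbove (h '' V) := by
  obtain ⟨C, hC⟩ := hh
  refine ⟨C, ?_⟩
  rintro _ ⟨y, -, rfl⟩
  exact (abs_le.1 (hC y)).2

theorem bddBelow_uEnv {X : Type*} [TopologicalSpace X] {h : X → ℝ} (hh : BddFun h) (x : X) :
    BddBelow {c | ∃ V : Set X, IsOpen V ∧ x ∈ V ∧ sSup (h '' V) = c} := by
  refine ⟨h x, ?_⟩
  rintro _ ⟨V, -, hx, rfl⟩
  exact le_csSup (hh.bddAbove_image V) (mem_image_of_mem h hx)

theorem uEnv_lt_iff {X : Type*} [TopologicalSpace X] {h : X → ℝ} (hh : BddFun h) (x : X)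
    (c : ℝ) : uEnv h x < c ↔ ∃ d < c, ∀ᶠ y in 𝓝 x, h y ≤ d := by
  constructor
  · intro hlt
    obtain ⟨_, ⟨V, hV, hx, rfl⟩, hd⟩ :=
      exists_lt_of_csInf_lt (by exact ⟨_, univ, isOpen_univ, mem_univ x, rfl⟩) hlt
    refine ⟨_, hd, ?_⟩
    filter_upwards [hV.mem_nhds hx] with y hy
    exact le_csSup (hh.bddAbove_image V) (mem_image_of_mem h hy)
  · rintro ⟨d, hd, hev⟩
    obtain ⟨V, hVd, hV, hx⟩ := eventually_nhds_iff.1 hev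
    refine lt_of_le_of_lt (csInf_le (bddBelow_uEnv hh x) ⟨V, hV, hx, rfl⟩)
      (lt_of_le_of_lt (csSup_le ⟨_, mem_image_of_mem h hx⟩ ?_) hd)
    rintro _ ⟨y, hy, rfl⟩
    exact hVd y hy

theorem BddFun.abs_sub_const {X : Type*} {f : X → ℝ} (hf : BddFun f) (a : ℝ) :
    BddFun fun y => |f y - a| := by
  obtain ⟨C, hC⟩ := hf
  refine ⟨C + |a|, fun y => ?_⟩
  rw [abs_abs]
  exact (abs_sub _ _).trans (by gcongr; exact hC y)

theorem losc_lt_iff {X : Type*} [TopologicalSpace X] {f : X → ℝ} (hf : BddFun f) (x : X)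
    (c : ℝ) : losc f x < c ↔ ∃ d < c, ∀ᶠ y in 𝓝 x, |f y - f x| ≤ d :=
  uEnv_lt_iff (hf.abs_sub_const (f x)) x c

theorem BddFun.losc {X : Type*} [TopologicalSpace X] {f : X → ℝ} (hf : BddFun f) :
    BddFun (losc f) := by
  obtain ⟨C, hC⟩ := id hf
  refine ⟨2 * C + 1, fun x => abs_le.2 ⟨?_, ?_⟩⟩
  · by_contra! hlt
    obtain ⟨d, hd, hev⟩ := (losc_lt_iff hf x _).1 hlt
    have h1 := hev.self_of_nhds
    have h2 := abs_nonneg (f x - f x)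
    have h3 := (abs_nonneg _).trans (hC x)
    linarith
  · refine ((losc_lt_iff hf x _).2 ⟨2 * C, by linarith, Eventually.of_forall fun y => ?_⟩).le
    have h1 := abs_le.1 (hC x)
    have h2 := abs_le.1 (hC y)
    exact abs_le.2 ⟨by linarith, by linarith⟩

theorem osc_lt_iff {X : Type*} [TopologicalSpace X] {f : X → ℝ} (hf : BddFun f) (x : X)
    (c : ℝ) : osc f x < c ↔ ∃ d < c, ∀ᶠ y in 𝓝 x, ∀ᶠ z in 𝓝 y, |f z - f y| ≤ d := by
  refine (uEnv_lt_iff hf.losc x c).trans ⟨?_, ?_⟩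
  · rintro ⟨d, hd, hev⟩
    obtain ⟨e, hde, hec⟩ := exists_between hd
    refine ⟨e, hec, hev.mono fun y hy => ?_⟩
    obtain ⟨b, hb, hb'⟩ := (losc_lt_iff hf y e).1 (hy.trans_lt hde)
    exact hb'.mono fun z hz => hz.trans hb.le
  · rintro ⟨d, hd, hev⟩
    refine ⟨d, hd, hev.mono fun y hy => le_of_forall_gt fun e he => ?_⟩
    exact (losc_lt_iff hf y e).2 ⟨d, he, hy⟩

/-- The oscillation of `f` restricted to `L` is smaller than `c` at the point `x`. -/
def OscWithinLT {X : Type*} [TopologicalSpace X] (f : X → ℝ) (L : Set X) (c : ℝ) (x : X) : Prop :=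
  ∃ d < c, ∀ᶠ y in 𝓝[L] x, ∀ᶠ z in 𝓝[L] y, |f z - f y| ≤ d

theorem osc_restrict_lt_iff {X : Type*} [TopologicalSpace X] {f : X → ℝ} (hf : BddFun f)
    {L : Set X} {x : X} (hx : x ∈ L) (c : ℝ) :
    osc (L.restrict f) ⟨x, hx⟩ < c ↔ OscWithinLT f L c x := by
  have hb : BddFun (L.restrict f) := hf.imp fun C hC y => hC y
  rw [osc_lt_iff hb]
  refine exists_congr fun d => and_congr_right fun _ => ?_
  rw [nhdsWithin_eq_map_subtype_coe hx, eventually_map]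
  refine eventually_congr (Eventually.of_forall fun y => ?_)
  rw [nhdsWithin_eq_map_subtype_coe y.2, eventually_map]
  rfl

theorem mem_osSet_succ {X : Type*} [TopologicalSpace X] {f : X → ℝ} (hf : BddFun f)
    {ε : ℝ} {n : ℕ} {x : X} :
    x ∈ osSet f ε (n + 1) ↔ x ∈ osSet f ε n ∧ ¬ OscWithinLT f (osSet f ε n) ε x := by
  constructor
  · rintro ⟨hx, hle⟩
    exact ⟨hx, fun hlt => hle.not_gt ((osc_restrict_lt_iff hf hx ε).2 hlt)⟩
  · rintro ⟨hx, hnot⟩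
    exact ⟨hx, not_lt.1 fun hlt => hnot ((osc_restrict_lt_iff hf hx ε).1 hlt)⟩

theorem OscWithinLT.eventually {X : Type*} [TopologicalSpace X] {f : X → ℝ} {L : Set X} {c : ℝ}
    {x : X} (h : OscWithinLT f L c x) : ∀ᶠ y in 𝓝[L] x, OscWithinLT f L c y := by
  obtain ⟨d, hd, hev⟩ := h
  exact (eventually_eventually_nhdsWithin.2 hev).mono fun y hy => ⟨d, hd, hy⟩

theorem OscWithinLT.mono_of_isOpen {X : Type*} [TopologicalSpace X] {f : X → ℝ} {L M U : Set X}
    {c : ℝ} {x : X} (h : OscWithinLT f M c x) (hU : IsOpen U) (hx : x ∈ U) (hLM : L ∩ U ⊆ M) :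
    OscWithinLT f L c x := by
  have hle : ∀ y ∈ U, 𝓝[L] y ≤ 𝓝[M] y := fun y hy => by
    rw [← nhdsWithin_inter_of_mem' (mem_nhdsWithin_of_mem_nhds (hU.mem_nhds hy))]
    exact nhdsWithin_mono y hLM
  obtain ⟨d, hd, hev⟩ := h
  refine ⟨d, hd, ?_⟩
  filter_upwards [hle x hx hev, mem_nhdsWithin_of_mem_nhds (hU.mem_nhds hx)] with y hy hyU
  exact hle y hyU hy

theorem OscWithinLT.mul {X : Type*} [TopologicalSpace X] {f g : X → ℝ} {L : Set X} {x : X}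
    {F G ε : ℝ} (hF : 0 < F) (hG : 0 < G) (hfF : ∀ y, |f y| ≤ F) (hgG : ∀ y, |g y| ≤ G)
    (hf : OscWithinLT f L (ε / (2 * G)) x) (hg : OscWithinLT g L (ε / (2 * F)) x) :
    OscWithinLT (f * g) L ε x := by
  obtain ⟨a, ha, hfa⟩ := hf
  obtain ⟨b, hb, hgb⟩ := hg
  rw [lt_div_iff₀ (by positivity)] at ha hb
  refine ⟨F * b + G * a, by linarith, ?_⟩
  filter_upwards [hfa, hgb] with y hfy hgy
  filter_upwards [hfy, hgy] with z hfz hgz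
  calc |(f * g) z - (f * g) y| = |f z * (g z - g y) + g y * (f z - f y)| := by
        simp only [Pi.mul_apply]; ring_nf
    _ ≤ |f z| * |g z - g y| + |g y| * |f z - f y| := by
        rw [← abs_mul, ← abs_mul]; exact abs_add_le _ _
    _ ≤ F * b + G * a := by
        gcongr
        · exact hfF z
        · exact hgG y

theorem isClosed_osSet {X : Type*} [TopologicalSpace X] {f : X → ℝ} (hf : BddFun f) (ε : ℝ)
    (n : ℕ) : IsClosed (osSet f ε n) := by
  induction n with
  | zero => exact isClosed_univ
  | succ n ih =>
    rw [← isOpen_compl_iff, isOpen_iff_mem_nhds]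
    intro x hx
    rw [mem_compl_iff, mem_osSet_succ hf, not_and_not_right] at hx
    by_cases hxn : x ∈ osSet f ε n
    · filter_upwards [eventually_nhdsWithin_iff.1 (hx hxn).eventually] with y hy hy'
      rw [mem_osSet_succ hf] at hy'
      exact hy'.2 (hy hy'.1)
    · filter_upwards [ih.isOpen_compl.mem_nhds hxn] with y hy hy'
      exact hy ((mem_osSet_succ hf).1 hy').1

theorem antitone_osSet {X : Type*} [TopologicalSpace X] (f : X → ℝ) (ε : ℝ) :
    Antitone (osSet f ε) :=
  antitone_nat_of_succ_le fun _ _ hx => hx.1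

theorem BddFun.mul {X : Type*} {f g : X → ℝ} (hf : BddFun f) (hg : BddFun g) :
    BddFun (f * g) := by
  obtain ⟨C, hC⟩ := hf
  obtain ⟨D, hD⟩ := hg
  refine ⟨C * D, fun x => ?_⟩
  rw [Pi.mul_apply, abs_mul]
  exact mul_le_mul (hC x) (hD x) (abs_nonneg _) ((abs_nonneg _).trans (hC x))

theorem BddFun.abs_le_supNorm {X : Type*} {f : X → ℝ} (hf : BddFun f) (x : X) :
    |f x| ≤ supNorm f := by
  obtain ⟨C, hC⟩ := hf
  exact le_ciSup (f := fun x => |f x|) ⟨C, by rintro _ ⟨y, rfl⟩; exact hC y⟩ x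

theorem exists_mem_osSet_of_mem_osSet_mul {X : Type*} [TopologicalSpace X] {f g : X → ℝ}
    (hbf : BddFun f) (hbg : BddFun g) (hF : 0 < supNorm f) (hG : 0 < supNorm g) (ε : ℝ) (n : ℕ)
    {x : X} (hx : x ∈ osSet (f * g) ε n) :
    ∃ i j, i + j = n ∧ x ∈ osSet f (ε / (2 * supNorm g)) i ∧
      x ∈ osSet g (ε / (2 * supNorm f)) j := by
  induction n generalizing x with
  | zero => exact ⟨0, 0, rfl, mem_univ x, mem_univ x⟩
  | succ n ih =>
    obtain ⟨hxn, hosc⟩ := (mem_osSet_succ (hbf.mul hbg)).1 hx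
    obtain ⟨i, j, hij, hi, hj⟩ := ih hxn
    by_cases hi' : x ∈ osSet f (ε / (2 * supNorm g)) (i + 1)
    · exact ⟨i + 1, j, by omega, hi', hj⟩
    by_cases hj' : x ∈ osSet g (ε / (2 * supNorm f)) (j + 1)
    · exact ⟨i, j + 1, by omega, hi, hj'⟩
    have hU := (isClosed_osSet hbf (ε / (2 * supNorm g)) (i + 1)).isOpen_compl.inter
      (isClosed_osSet hbg (ε / (2 * supNorm f)) (j + 1)).isOpen_compl
    have hloc : ∀ y ∈ osSet (f * g) ε n ∩ ((osSet f (ε / (2 * supNorm g)) (i + 1))ᶜ ∩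
        (osSet g (ε / (2 * supNorm f)) (j + 1))ᶜ),
        y ∈ osSet f (ε / (2 * supNorm g)) i ∧ y ∈ osSet g (ε / (2 * supNorm f)) j := by
      rintro y ⟨hyn, hyf, hyg⟩
      obtain ⟨k, l, hkl, hk, hl⟩ := ih hyn
      have hki : k < i + 1 := not_le.1 fun h => hyf (antitone_osSet _ _ h hk)
      have hlj : l < j + 1 := not_le.1 fun h => hyg (antitone_osSet _ _ h hl)
      obtain rfl : k = i := by omega
      obtain rfl : l = j := by omega
      exact ⟨hk, hl⟩
    rw [mem_osSet_succ hbf, not_and_not_right] at hi'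
    rw [mem_osSet_succ hbg, not_and_not_right] at hj'
    have hxU : x ∈ (osSet f (ε / (2 * supNorm g)) (i + 1))ᶜ ∩
        (osSet g (ε / (2 * supNorm f)) (j + 1))ᶜ :=
      ⟨fun h => ((mem_osSet_succ hbf).1 h).2 (hi' hi),
        fun h => ((mem_osSet_succ hbg).1 h).2 (hj' hj)⟩
    exact absurd (OscWithinLT.mul hF hG hbf.abs_le_supNorm hbg.abs_le_supNorm
      ((hi' hi).mono_of_isOpen hU hxU fun y hy => (hloc y hy).1)
      ((hj' hj).mono_of_isOpen hU hxU fun y hy => (hloc y hy).2)) hosc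

theorem le_oscIndex {X : Type*} [TopologicalSpace X] {f : X → ℝ} {ε : ℝ} {n : ℕ}
    (h : (osSet f ε n).Nonempty) : (n : ℕ∞) ≤ oscIndex f ε :=
  le_iSup₂ (f := fun (m : ℕ) (_ : (osSet f ε m).Nonempty) => (m : ℕ∞)) n h

/-- **Theorem 2.8 (b).** `i(f·g, ε) ≤ i(f, ε/(2G)) + i(g, ε/(2F))` where
`F = ‖f‖_∞ > 0` and `G = ‖g‖_∞ > 0`. -/
theorem oscIndex_mul_le {K : Type*} [MetricSpace K]
    [TopologicalSpace.SeparableSpace K] (f g : K → ℝ)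
    (hbf : BddFun f) (hbg : BddFun g)
    (hf : MemBHalf f) (hg : MemBHalf g)
    (hF : 0 < supNorm f) (hG : 0 < supNorm g) (ε : ℝ) (hε : 0 < ε) :
    oscIndex (f * g) ε ≤
      oscIndex f (ε / (2 * supNorm g)) + oscIndex g (ε / (2 * supNorm f)) := by
  refine iSup₂_le fun n hn => ?_
  obtain ⟨x, hx⟩ := hn
  obtain ⟨i, j, rfl, hi, hj⟩ := exists_mem_osSet_of_mem_osSet_mul hbf hbg hF hG ε n hx
  rw [Nat.cast_add]
  exact add_le_add (le_oscIndex ⟨x, hi⟩) (le_oscIndex ⟨x, hj⟩)
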